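/- arXiv:2109.07610 — 2 statements merged into one kernel-verified Lean document; each statement's English description precedes it below -/
import Mathlib

section
/- Assume the Goldberg–Seymour statement: every multigraph H with χ'(H) ≥ Δ(H)+2 satisfies χ'(H) = ⌈ρ(H)⌉. Assume also that for every edge-chromatic critical multigraph H with χ'(H) ≥ Δ(H)+2 and every edge e of H there is a proper edge (χ'(H)−1)-coloring of H−e under which V(H) is elementary. Let G be a multigraph with χ'(G) ≥ Δ(G)+2 and let H be an edge-chromatic critical subgraph of G with χ'(H) = χ'(G). If |V(H)| ≥ (|V(G)|−2)/(χ'(G)−Δ(G)−1), then χ''(G) = χ'(G). -/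
/-- A multigraph: a finite graph possibly with parallel edges but no loops.
Edges are abstract objects, each mapped to an unordered pair of distinct vertices. -/
structure Multigraph where
  V : Type
  E : Type
  fintypeV : Fintype V
  fintypeE : Fintype E
  decEqV : DecidableEq V
  decEqE : DecidableEq E
  ends : E → Sym2 V
  loopless : ∀ e, ¬ (ends e).IsDiag

attribute [instance] Multigraph.fintypeV Multigraph.fintypeE
attribute [instance] Multigraph.decEqV Multigraph.decEqE

namespace Multigraph

variable (G : Multigraph)

/-- The degree of a vertex: the number of edges incident with it. -/
def degree (v : G.V) : ℕ :=
  (Finset.univ.filter fun e : G.E => v ∈ G.ends e).card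

/-- The maximum degree Δ(G). -/
def maxDegree : ℕ :=
  Finset.univ.sup G.degree

/-- A proper edge coloring with color set `Fin k`: edges sharing an endpoint
receive distinct colors. -/
def IsProperEdgeColoring {k : ℕ} (φ : G.E → Fin k) : Prop :=
  ∀ e f : G.E, e ≠ f → (∃ v, v ∈ G.ends e ∧ v ∈ G.ends f) → φ e ≠ φ f

/-- The chromatic index χ'(G): the least `k` admitting a proper edge `k`-coloring. -/
noncomputable def chromaticIndex : ℕ :=
  sInf {k | ∃ φ : G.E → Fin k, G.IsProperEdgeColoring φ}

/-- Two vertices are adjacent if some edge joins them. -/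
def Adj (u v : G.V) : Prop := ∃ e, G.ends e = s(u, v)

/-- A proper total coloring with color set `Fin k`: no two adjacent or incident
elements of `V(G) ∪ E(G)` receive the same color. -/
def IsProperTotalColoring {k : ℕ} (cV : G.V → Fin k) (cE : G.E → Fin k) : Prop :=
  G.IsProperEdgeColoring cE ∧
  (∀ u v : G.V, G.Adj u v → cV u ≠ cV v) ∧
  (∀ v e, v ∈ G.ends e → cV v ≠ cE e)

/-- The total chromatic number χ''(G): the least `k` admitting a proper total
`k`-coloring. -/
noncomputable def totalChromaticNumber : ℕ :=
  sInf {k | ∃ (cV : G.V → Fin k) (cE : G.E → Fin k), G.IsProperTotalColoring cV cE}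

/-- `H` is a subgraph of `G`: there are injections of the vertices and edges of `H`
into those of `G` preserving the incidence structure. -/
def IsSubgraph (H G : Multigraph) : Prop :=
  ∃ (f : H.V → G.V) (g : H.E → G.E),
    Function.Injective f ∧ Function.Injective g ∧
    ∀ e, G.ends (g e) = (H.ends e).map f

/-- `H` is a spanning subgraph of `G`: a subgraph whose vertex set is all of `V(G)`. -/
def IsSpanningSubgraph (H G : Multigraph) : Prop :=
  ∃ (f : H.V → G.V) (g : H.E → G.E),
    Function.Bijective f ∧ Function.Injective g ∧
    ∀ e, G.ends (g e) = (H.ends e).map f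

/-- `H` is a proper subgraph of `G`. -/
def IsProperSubgraph (H G : Multigraph) : Prop :=
  IsSubgraph H G ∧ ¬ IsSubgraph G H

/-- `G` is edge-chromatic critical: every proper subgraph has a smaller chromatic index. -/
def EdgeChromaticCritical (G : Multigraph) : Prop :=
  ∀ H : Multigraph, IsProperSubgraph H G → H.chromaticIndex < G.chromaticIndex

/-- The density ρ(G) = max{2|E(H)|/(|V(H)|−1) : H ⊆ G, |V(H)| ≥ 3 odd}
(0 if no such subgraph exists). -/
noncomputable def density (G : Multigraph) : ℝ :=
  sSup ({0} ∪ {q : ℝ | ∃ H : Multigraph, IsSubgraph H G ∧ Odd (Fintype.card H.V) ∧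
    3 ≤ Fintype.card H.V ∧
    q = 2 * (Fintype.card H.E : ℝ) / ((Fintype.card H.V : ℝ) - 1)})

/-- A subgraph of `G` given by a set of vertices and a set of edges of `G`
whose endpoints all lie in the chosen vertex set. -/
structure Sub (G : Multigraph) where
  verts : Finset G.V
  edges : Finset G.E
  support : ∀ e ∈ edges, ∀ v, v ∈ G.ends e → v ∈ verts

/-- A subgraph is `k`-dense if its order is odd and at least 3, and
`2|E(H)| = k(|V(H)|−1)`. -/
def Sub.IsDense {G : Multigraph} (S : G.Sub) (k : ℕ) : Prop :=
  Odd S.verts.card ∧ 3 ≤ S.verts.card ∧ 2 * S.edges.card = k * (S.verts.card - 1)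

/-- A subgraph is maximal `k`-dense if it is `k`-dense and no `k`-dense subgraph
contains it as a proper subgraph. -/
def Sub.MaximalDense {G : Multigraph} (S : G.Sub) (k : ℕ) : Prop :=
  S.IsDense k ∧ ∀ T : G.Sub, T.IsDense k → S.verts ⊆ T.verts → S.edges ⊆ T.edges →
    S.verts = T.verts ∧ S.edges = T.edges

/-- The set of colors of `Fin k` missing at `v` under the edge coloring `φ`. -/
def missing {k : ℕ} (φ : G.E → Fin k) (v : G.V) : Set (Fin k) :=
  {c | ∀ e : G.E, v ∈ G.ends e → φ e ≠ c}

/-- A vertex set `W` is elementary under `φ` if the sets of missing colors of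
distinct vertices of `W` are disjoint. -/
def Elementary {k : ℕ} (φ : G.E → Fin k) (W : Set G.V) : Prop :=
  ∀ u ∈ W, ∀ v ∈ W, u ≠ v → Disjoint (G.missing φ u) (G.missing φ v)

/-- An edge is a boundary edge of `W` if exactly one of its ends lies in `W`. -/
def IsBoundaryEdge (W : Set G.V) (e : G.E) : Prop :=
  ∃ a b, G.ends e = s(a, b) ∧ a ∈ W ∧ b ∉ W

/-- Deleting an edge from a multigraph. -/
def deleteEdge (G : Multigraph) (e : G.E) : Multigraph where
  V := G.V
  E := {f : G.E // f ≠ e}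
  fintypeV := G.fintypeV
  fintypeE := by classical exact inferInstance
  decEqV := G.decEqV
  decEqE := by classical exact inferInstance
  ends := fun f => G.ends f.1
  loopless := fun f => G.loopless f.1

/-- Adding a new edge joining two distinct vertices of a multigraph. -/
def addEdge (G : Multigraph) (u v : G.V) (huv : u ≠ v) : Multigraph where
  V := G.V
  E := Option G.E
  fintypeV := G.fintypeV
  fintypeE := inferInstance
  decEqV := G.decEqV
  decEqE := inferInstance
  ends := fun e => e.elim s(u, v) G.ends
  loopless := fun e => by
    cases e with
    | none => simpa using huv
    | some f => exact G.loopless f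

end Multigraph

open Multigraph

namespace Multigraph

/-- Handshaking for a set of edges. -/
lemma sum_card_filter_mem_ends (G : Multigraph) (S : Finset G.E) :
    ∑ v, (S.filter fun e => v ∈ G.ends e).card = 2 * S.card := by
  have h := Finset.sum_card_bipartiteAbove_eq_sum_card_bipartiteBelow
    (s := (Finset.univ : Finset G.V)) (t := S) (fun v e => v ∈ G.ends e)
  simp only [Finset.bipartiteAbove, Finset.bipartiteBelow] at h
  rw [h, Finset.sum_const_nat (m := 2), mul_comm]
  intro e _
  rw [← Sym2.card_toFinset_of_not_isDiag _ (G.loopless e)]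
  congr 1
  ext v
  simp

lemma sum_degree (G : Multigraph) : ∑ v, G.degree v = 2 * Fintype.card G.E :=
  G.sum_card_filter_mem_ends Finset.univ

lemma degree_le_maxDegree (G : Multigraph) (v : G.V) : G.degree v ≤ G.maxDegree :=
  Finset.le_sup (f := G.degree) (Finset.mem_univ v)

lemma exists_proper_chromaticIndex (G : Multigraph) :
    ∃ φ : G.E → Fin G.chromaticIndex, G.IsProperEdgeColoring φ :=
  Nat.sInf_mem (s := {k | ∃ φ : G.E → Fin k, G.IsProperEdgeColoring φ})
    ⟨Fintype.card G.E, Fintype.equivFin G.E,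
      fun _ _ hne _ h => hne ((Fintype.equivFin G.E).injective h)⟩

lemma chromaticIndex_le {G : Multigraph} {k : ℕ} (φ : G.E → Fin k)
    (hφ : G.IsProperEdgeColoring φ) : G.chromaticIndex ≤ k :=
  Nat.sInf_le ⟨φ, hφ⟩

/-- A graph of odd order with a proper edge `k`-coloring has at most `k(|V|-1)/2` edges. -/
lemma two_mul_card_edges_le_of_odd {G : Multigraph} {k : ℕ} (φ : G.E → Fin k)
    (hφ : G.IsProperEdgeColoring φ) (hodd : Odd (Fintype.card G.V)) :
    2 * Fintype.card G.E ≤ k * (Fintype.card G.V - 1) := by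
  have hcolor (c : Fin k) :
      2 * (Finset.univ.filter fun e => φ e = c).card ≤ Fintype.card G.V - 1 := by
    have h : 2 * (Finset.univ.filter fun e => φ e = c).card ≤ Fintype.card G.V := by
      rw [← G.sum_card_filter_mem_ends, ← Finset.card_univ, Finset.card_eq_sum_ones]
      refine Finset.sum_le_sum fun v _ => Finset.card_le_one.2 fun e he f hf => ?_
      simp only [Finset.mem_filter, Finset.mem_univ, true_and] at he hf
      by_contra hne
      exact hφ e f hne ⟨v, he.2, hf.2⟩ (he.1.trans hf.1.symm)
    obtain ⟨m, hm⟩ := hodd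
    omega
  have hsum : Fintype.card G.E = ∑ c, (Finset.univ.filter fun e => φ e = c).card := by
    rw [← Finset.card_univ]
    exact Finset.card_eq_sum_card_fiberwise fun _ _ => Finset.mem_univ _
  rw [hsum, Finset.mul_sum]
  calc _ ≤ ∑ _c : Fin k, (Fintype.card G.V - 1) := Finset.sum_le_sum fun c _ => hcolor c
    _ = _ := by simp

lemma degree_le_of_embedding {H G : Multigraph} {f : H.V → G.V} {g : H.E → G.E}
    (hg : Function.Injective g) (hfg : ∀ e, G.ends (g e) = (H.ends e).map f) (v : H.V) :
    H.degree v ≤ G.degree (f v) := by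
  refine Finset.card_le_card_of_injOn g (fun e he => ?_) hg.injOn
  simp only [Finset.coe_filter, Finset.mem_univ, true_and, Set.mem_ofPred_eq] at he ⊢
  rw [hfg]
  exact Sym2.mem_map.2 ⟨v, he, rfl⟩

lemma IsSubgraph.maxDegree_le {H G : Multigraph} (h : IsSubgraph H G) :
    H.maxDegree ≤ G.maxDegree := by
  obtain ⟨f, g, -, hg, hfg⟩ := h
  exact Finset.sup_le fun v _ => (degree_le_of_embedding hg hfg v).trans (G.degree_le_maxDegree _)

lemma le_card_missing_add_degree (G : Multigraph) {k : ℕ} (φ : G.E → Fin k) (v : G.V) :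
    k ≤ (G.missing φ v).ncard + G.degree v := by
  classical
  have hc : (G.missing φ v)ᶜ =
      ((Finset.univ.filter fun e => v ∈ G.ends e).image φ : Finset (Fin k)) := by
    ext c
    simp [missing]
  have h := Set.ncard_add_ncard_compl (G.missing φ v)
  rw [hc, Set.ncard_coe_finset, Nat.card_eq_fintype_card, Fintype.card_fin] at h
  have := Finset.card_image_le (s := Finset.univ.filter fun e => v ∈ G.ends e) (f := φ)
  unfold degree
  omega

/-- If all vertices together are elementary, the missing colors number at most `k`. -/
lemma Elementary.card_mul_le {G : Multigraph} {k : ℕ} {φ : G.E → Fin k}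
    (h : G.Elementary φ Set.univ) :
    Fintype.card G.V * k ≤ k + 2 * Fintype.card G.E := by
  classical
  have hsum : ∑ v, (G.missing φ v).ncard ≤ k := by
    simp only [Set.ncard_eq_toFinset_card']
    rw [← Finset.card_biUnion]
    · exact (Finset.card_le_univ _).trans_eq (Fintype.card_fin k)
    · intro u _ v _ huv
      exact Set.disjoint_toFinset.2 (h u trivial v trivial huv)
  calc Fintype.card G.V * k = ∑ _v : G.V, k := by simp
    _ ≤ ∑ v, ((G.missing φ v).ncard + G.degree v) :=
      Finset.sum_le_sum fun v _ => G.le_card_missing_add_degree φ v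
    _ ≤ _ := by
      rw [Finset.sum_add_distrib, sum_degree]
      omega

lemma card_deleteEdge (G : Multigraph) (e : G.E) :
    Fintype.card (G.deleteEdge e).E + 1 = Fintype.card G.E := by
  have h : Fintype.card (G.deleteEdge e).E = Fintype.card {f : G.E // f ≠ e} :=
    Fintype.card_congr (Equiv.refl _)
  rw [h, ← Fintype.card_option]
  exact Fintype.card_congr (Equiv.optionSubtypeNe e)

/-- The cone over `G`: a new vertex `none` joined by one edge to every vertex of `G`. -/
def cone (G : Multigraph) : Multigraph where
  V := Option G.V
  E := G.E ⊕ G.V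
  fintypeV := inferInstance
  fintypeE := inferInstance
  decEqV := inferInstance
  decEqE := inferInstance
  ends := Sum.elim (fun e => (G.ends e).map some) (fun v => s(none, some v))
  loopless := by
    rintro (e | v)
    · simpa [Sym2.isDiag_map (Option.some_injective _)] using G.loopless e
    · simp

lemma cone_ends_inl (G : Multigraph) (e : G.E) :
    G.cone.ends (.inl e) = (G.ends e).map some := rfl

lemma cone_ends_inr (G : Multigraph) (v : G.V) :
    G.cone.ends (.inr v) = s(none, some v) := rfl

lemma mem_cone_ends_inl {G : Multigraph} {e : G.E} {v : G.V} :
    (some v : G.cone.V) ∈ G.cone.ends (.inl e) ↔ v ∈ G.ends e := by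
  rw [cone_ends_inl]
  exact Sym2.mem_map.trans (by simp)

lemma none_notMem_cone_ends_inl {G : Multigraph} {e : G.E} :
    (none : G.cone.V) ∉ G.cone.ends (.inl e) := by
  rw [cone_ends_inl]
  exact fun h => by simpa using Sym2.mem_map.1 h

lemma mem_cone_ends_inr {G : Multigraph} {u : G.V} {v : Option G.V} :
    v ∈ G.cone.ends (.inr u) ↔ v = none ∨ v = some u := by
  rw [cone_ends_inr]
  exact Sym2.mem_iff

lemma degree_cone_some_le (G : Multigraph) (v : G.V) :
    G.cone.degree (some v) ≤ G.degree v + 1 := by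
  let x : G.cone.V := some v
  let inl : G.E → G.cone.E := Sum.inl
  let apexEdge : G.cone.E := Sum.inr v
  have hsub : (Finset.univ.filter fun e => x ∈ G.cone.ends e) ⊆
      insert apexEdge ((Finset.univ.filter fun e => v ∈ G.ends e).image inl) := by
    rintro (e | u) h
    · refine Finset.mem_insert_of_mem (Finset.mem_image_of_mem inl ?_)
      exact Finset.mem_filter.2 ⟨Finset.mem_univ e, mem_cone_ends_inl.1 (Finset.mem_filter.1 h).2⟩
    · rcases mem_cone_ends_inr.1 (Finset.mem_filter.1 h).2 with h | h
      · exact absurd h (Option.some_ne_none v)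
      · obtain rfl := Option.some.inj h
        exact Finset.mem_insert_self _ _
  refine (Finset.card_le_card hsub).trans ((Finset.card_insert_le _ _).trans ?_)
  exact Nat.add_le_add_right Finset.card_image_le 1

lemma degree_cone_none_le (G : Multigraph) :
    G.cone.degree none ≤ Fintype.card G.V := by
  let apex : G.cone.V := none
  let inr : G.V → G.cone.E := Sum.inr
  have hsub : (Finset.univ.filter fun e => apex ∈ G.cone.ends e) ⊆
      Finset.univ.image inr := by
    rintro (e | u) h
    · exact absurd (Finset.mem_filter.1 h).2 none_notMem_cone_ends_inl
    · exact Finset.mem_image_of_mem inr (Finset.mem_univ u)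
  exact (Finset.card_le_card hsub).trans Finset.card_image_le

lemma maxDegree_cone_le (G : Multigraph) :
    G.cone.maxDegree ≤ max (G.maxDegree + 1) (Fintype.card G.V) := by
  refine Finset.sup_le fun v _ => ?_
  rcases v with _ | v
  · exact le_max_of_le_right G.degree_cone_none_le
  · exact le_max_of_le_left
      ((G.degree_cone_some_le v).trans (Nat.add_le_add_right (G.degree_le_maxDegree v) 1))

/-- The apex of the cone has at most one edge to each other vertex in any subgraph. -/
lemma degree_le_card_sub_one_of_map_eq_none {S G : Multigraph} {f : S.V → G.cone.V}
    {g : S.E → G.cone.E}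
    (hg : Function.Injective g) (hfg : ∀ e, G.cone.ends (g e) = (S.ends e).map f)
    {w : S.V} (hw : f w = none) : S.degree w ≤ Fintype.card S.V - 1 := by
  classical
  have hother : ∀ e, w ∈ S.ends e → ∃ x, x ≠ w ∧ ∃ u : G.V, f x = some u ∧ g e = .inr u := by
    intro e he
    obtain ⟨x, hx⟩ := Sym2.mem_iff_exists.1 he
    have hxw : x ≠ w := by
      rintro rfl
      exact S.loopless e (by simp [hx])
    have hends := hfg e
    rw [hx, Sym2.map_mk, hw] at hends
    rcases hge : g e with e' | u
    · refine absurd ?_ (none_notMem_cone_ends_inl (e := e'))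
      rw [← hge, hends]
      exact Sym2.mem_mk_left _ _
    · refine ⟨x, hxw, u, ?_, rfl⟩
      rw [hge, cone_ends_inr] at hends
      exact (Sym2.congr_right.1 hends).symm
  have : Nonempty S.V := ⟨w⟩
  choose! x hxw hx using hother
  rw [← Finset.card_univ, ← Finset.card_erase_of_mem (Finset.mem_univ w)]
  refine Finset.card_le_card_of_injOn x (fun e he => ?_) fun e he e' he' hee => ?_
  · simp only [Finset.coe_filter, Finset.mem_univ, true_and, Set.mem_ofPred_eq] at he
    simpa using hxw e he
  · simp only [Finset.coe_filter, Finset.mem_univ, true_and, Set.mem_ofPred_eq] at he he'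
    obtain ⟨u, hfx, hgu⟩ := hx e he
    obtain ⟨u', hfx', hgu'⟩ := hx e' he'
    have h : (some u : Option G.V) = some u' := hfx.symm.trans ((congrArg f hee).trans hfx')
    exact hg (by rw [hgu, hgu', Option.some.inj h])

lemma two_mul_card_edges_le_of_subgraph_cone {S G : Multigraph} (hS : IsSubgraph S G.cone)
    (hodd : Odd (Fintype.card S.V)) (hG : G.maxDegree + 2 ≤ G.chromaticIndex) :
    2 * Fintype.card S.E ≤ G.chromaticIndex * (Fintype.card S.V - 1) := by
  classical
  obtain ⟨f, g, hf, hg, hfg⟩ := hS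
  by_cases hw : ∃ w, f w = none
  · obtain ⟨w, hw⟩ := hw
    have hdeg : ∀ v ∈ Finset.univ.erase w, S.degree v ≤ G.maxDegree + 1 := by
      intro v hv
      refine (degree_le_of_embedding hg hfg v).trans ?_
      rcases hfv : f v with _ | u
      · exact absurd (hf (hfv.trans hw.symm)) (Finset.ne_of_mem_erase hv)
      · exact (G.degree_cone_some_le u).trans (Nat.add_le_add_right (G.degree_le_maxDegree u) 1)
    have hsum := Finset.sum_le_card_nsmul _ _ _ hdeg
    rw [Finset.card_erase_of_mem (Finset.mem_univ w), Finset.card_univ, smul_eq_mul] at hsum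
    have hapex := degree_le_card_sub_one_of_map_eq_none hg hfg hw
    rw [← S.sum_degree, ← Finset.add_sum_erase _ _ (Finset.mem_univ w)]
    nlinarith
  · have hinl : ∀ e, ∃ e', g e = .inl e' := by
      intro e
      rcases hge : g e with e' | u
      · exact ⟨e', rfl⟩
      · have hmem : (none : G.cone.V) ∈ (S.ends e).map f := by
          rw [← hfg, hge]
          exact mem_cone_ends_inr.2 (.inl rfl)
        obtain ⟨v, -, hv⟩ := Sym2.mem_map.1 hmem
        exact absurd ⟨v, hv⟩ hw
    choose g' hg' using hinl
    obtain ⟨φ, hφ⟩ := G.exists_proper_chromaticIndex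
    refine two_mul_card_edges_le_of_odd (φ ∘ g') (fun e e' hne hv => ?_) hodd
    obtain ⟨v, hve, hve'⟩ := hv
    refine hφ _ _ (fun h => hne (hg (by rw [hg', hg', h]))) ?_
    rcases hfv : f v with _ | u
    · exact absurd ⟨v, hfv⟩ hw
    · have hmem : ∀ d, v ∈ S.ends d → u ∈ G.ends (g' d) := by
        intro d hd
        rw [← mem_cone_ends_inl, ← hg', hfg, ← hfv]
        exact Sym2.mem_map.2 ⟨v, hd, rfl⟩
      exact ⟨u, hmem e hve, hmem e' hve'⟩

lemma density_cone_le {G : Multigraph} (hG : G.maxDegree + 2 ≤ G.chromaticIndex) :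
    G.cone.density ≤ G.chromaticIndex := by
  refine csSup_le ⟨0, .inl rfl⟩ ?_
  rintro q (rfl | ⟨S, hS, hodd, h3, rfl⟩)
  · positivity
  · have h := two_mul_card_edges_le_of_subgraph_cone hS hodd hG
    have h1 : (1 : ℝ) < Fintype.card S.V := by exact_mod_cast (by omega)
    rw [div_le_iff₀ (by linarith), ← Nat.cast_one (R := ℝ), ← Nat.cast_sub (by omega)]
    exact_mod_cast h

/-- An edge coloring of the cone is a total coloring of the base, with distinct vertex colors. -/
lemma exists_totalColoring_of_cone {G : Multigraph} {k : ℕ} (ψ : G.cone.E → Fin k)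
    (hψ : G.cone.IsProperEdgeColoring ψ) :
    ∃ (cV : G.V → Fin k) (cE : G.E → Fin k), G.IsProperTotalColoring cV cE := by
  refine ⟨fun v => ψ (.inr v), fun e => ψ (.inl e), ?_, ?_, ?_⟩
  · rintro e e' hne ⟨v, hv, hv'⟩
    exact hψ _ _ (fun h => hne (Sum.inl_injective h))
      ⟨some v, mem_cone_ends_inl.2 hv, mem_cone_ends_inl.2 hv'⟩
  · rintro u v ⟨e, he⟩
    refine hψ _ _ (fun h => ?_)
      ⟨none, mem_cone_ends_inr.2 (.inl rfl), mem_cone_ends_inr.2 (.inl rfl)⟩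
    obtain rfl : u = v := Sum.inr_injective h
    exact G.loopless e (by simp [he])
  · intro v e hv
    exact hψ _ _ Sum.inr_ne_inl ⟨some v, mem_cone_ends_inr.2 (.inr rfl), mem_cone_ends_inl.2 hv⟩

lemma chromaticIndex_le_totalChromaticNumber {G : Multigraph} {k : ℕ}
    (h : ∃ (cV : G.V → Fin k) (cE : G.E → Fin k), G.IsProperTotalColoring cV cE) :
    G.chromaticIndex ≤ G.totalChromaticNumber := by
  obtain ⟨_, cE, hc⟩ := Nat.sInf_mem
    (s := {k | ∃ (cV : G.V → Fin k) (cE : G.E → Fin k), G.IsProperTotalColoring cV cE}) ⟨k, h⟩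
  exact chromaticIndex_le cE hc.1

/-- A deleted edge whose removal leaves an elementary `k`-coloring forces few vertices. -/
lemma card_mul_add_two_le {H : Multigraph} {k D : ℕ} (hD : H.maxDegree ≤ D) (e : H.E)
    {φ : (H.deleteEdge e).E → Fin k} (hφ : (H.deleteEdge e).Elementary φ Set.univ) :
    Fintype.card H.V * k + 2 ≤ k + Fintype.card H.V * D := by
  have hle : Fintype.card H.V * k ≤ k + 2 * Fintype.card (H.deleteEdge e).E := hφ.card_mul_le
  have hdel := H.card_deleteEdge e
  have hsum : 2 * Fintype.card H.E ≤ Fintype.card H.V * D := by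
    rw [← H.sum_degree]
    calc _ ≤ ∑ _v : H.V, D := Finset.sum_le_sum fun v _ => (H.degree_le_maxDegree v).trans hD
      _ = _ := by simp
  omega

end Multigraph

/-- Assuming Goldberg–Seymour and the elementary-coloring property of
edge-chromatic critical multigraphs, if `G` has χ'(G) ≥ Δ(G)+2 and a critical
subgraph `H` with χ'(H) = χ'(G) and |V(H)| ≥ (|V(G)|−2)/(χ'(G)−Δ(G)−1), then
χ''(G) = χ'(G). -/
theorem total_eq_chromaticIndex_of_large_critical_subgraph
    (GS : ∀ H : Multigraph, H.maxDegree + 2 ≤ H.chromaticIndex →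
      H.chromaticIndex = ⌈H.density⌉₊)
    (TC : ∀ H : Multigraph, H.EdgeChromaticCritical →
      H.maxDegree + 2 ≤ H.chromaticIndex → ∀ e : H.E,
      ∃ φ : (H.deleteEdge e).E → Fin (H.chromaticIndex - 1),
        (H.deleteEdge e).IsProperEdgeColoring φ ∧
        (H.deleteEdge e).Elementary φ Set.univ)
    (G H : Multigraph)
    (hGΔ : G.maxDegree + 2 ≤ G.chromaticIndex)
    (hsub : IsSubgraph H G)
    (hcrit : H.EdgeChromaticCritical)
    (hchi : H.chromaticIndex = G.chromaticIndex)
    (hcard : ((Fintype.card G.V : ℝ) - 2) /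
        ((G.chromaticIndex : ℝ) - (G.maxDegree : ℝ) - 1) ≤ (Fintype.card H.V : ℝ)) :
    G.totalChromaticNumber = G.chromaticIndex := by
  have hΔ := hsub.maxDegree_le
  have hcardV : Fintype.card G.V + 1 ≤ G.chromaticIndex := by
    obtain ⟨e⟩ : Nonempty H.E := by
      by_contra hE
      rw [not_nonempty_iff] at hE
      have : H.chromaticIndex ≤ 0 := chromaticIndex_le (fun e => hE.elim e) fun e => hE.elim e
      omega
    obtain ⟨φ, -, hφ⟩ := TC H hcrit (by omega) e
    have hcount := card_mul_add_two_le hΔ e hφ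
    obtain ⟨d, hd⟩ := Nat.exists_eq_add_of_le hGΔ
    rw [hchi, hd, show G.maxDegree + 2 + d - 1 = G.maxDegree + (d + 1) by omega] at hcount
    rw [hd] at hcard ⊢
    push_cast at hcard
    rw [show (G.maxDegree : ℝ) + 2 + d - G.maxDegree - 1 = d + 1 by ring,
      div_le_iff₀ (by positivity)] at hcard
    have hle : Fintype.card G.V ≤ Fintype.card H.V * (d + 1) + 2 := by
      have : (Fintype.card G.V : ℝ) ≤ Fintype.card H.V * (d + 1) + 2 := by linarith
      exact_mod_cast this
    rw [mul_add] at hcount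
    omega
  have hcone : G.cone.chromaticIndex ≤ G.chromaticIndex := by
    by_cases h : G.cone.maxDegree + 2 ≤ G.cone.chromaticIndex
    · rw [GS _ h]
      exact Nat.ceil_le.2 (density_cone_le hGΔ)
    · have := G.maxDegree_cone_le
      omega
  obtain ⟨ψ, hψ⟩ := G.cone.exists_proper_chromaticIndex
  have htotal := exists_totalColoring_of_cone (fun e => Fin.castLE hcone (ψ e))
    fun e e' hne hv h => hψ e e' hne hv (Fin.castLE_injective hcone h)
  exact le_antisymm (Nat.sInf_le htotal) (chromaticIndex_le_totalChromaticNumber htotal)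
end

section
/- Assume the Goldberg–Seymour statement: every multigraph H with χ'(H) ≥ Δ(H)+2 satisfies χ'(H) = ⌈ρ(H)⌉. Let G be a multigraph with ρ(G) ≤ k, let u and v be distinct vertices of G, and let G'' be the multigraph obtained from G by adding one new edge e joining u and v. If Δ(G'') ≤ k−1 and χ'(G'') ≥ k+1, then G contains a k-dense subgraph whose vertex set contains both u and v. -/
open Multigraph

namespace Multigraph

theorem IsSubgraph.two_mul_card_le_density {H G : Multigraph} (hHG : IsSubgraph H G)
    (hodd : Odd (Fintype.card H.V)) (hcard : 3 ≤ Fintype.card H.V) :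
    2 * (Fintype.card H.E : ℝ) / ((Fintype.card H.V : ℝ) - 1) ≤ G.density := by
  refine le_csSup ⟨2 * (Fintype.card G.E : ℝ), ?_⟩ (Or.inr ⟨H, hHG, hodd, hcard, rfl⟩)
  rintro q (rfl | ⟨K, ⟨_, g, _, hg, _⟩, _, hK, rfl⟩)
  · positivity
  · have hE : (Fintype.card K.E : ℝ) ≤ Fintype.card G.E := by
      exact_mod_cast Fintype.card_le_of_injective g hg
    have hV : (3 : ℝ) ≤ Fintype.card K.V := by exact_mod_cast hK
    calc 2 * (Fintype.card K.E : ℝ) / ((Fintype.card K.V : ℝ) - 1)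
        ≤ 2 * (Fintype.card K.E : ℝ) := div_le_self (by positivity) (by linarith)
      _ ≤ 2 * (Fintype.card G.E : ℝ) := by linarith

theorem exists_subgraph_of_lt_density {G : Multigraph} {r : ℝ} (hr : 0 ≤ r)
    (h : r < G.density) :
    ∃ H : Multigraph, IsSubgraph H G ∧ Odd (Fintype.card H.V) ∧ 3 ≤ Fintype.card H.V ∧
      r < 2 * (Fintype.card H.E : ℝ) / ((Fintype.card H.V : ℝ) - 1) := by
  rw [density] at h
  obtain ⟨q, hq, hlt⟩ := exists_lt_of_lt_csSup ((Set.singleton_nonempty 0).inl) h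
  rcases hq with rfl | ⟨H, hH, hodd, hcard, rfl⟩
  · exact absurd hlt hr.not_gt
  · exact ⟨H, hH, hodd, hcard, hlt⟩

theorem card_deleteEdge_E_add_one (H : Multigraph) (e : H.E) :
    Fintype.card (H.deleteEdge e).E + 1 = Fintype.card H.E := by
  have h : Fintype.card (H.deleteEdge e).E = Fintype.card {f : H.E // f ≠ e} :=
    Fintype.card_congr (Equiv.refl _)
  have hpos : 0 < Fintype.card H.E := Fintype.card_pos_iff.mpr ⟨e⟩
  rw [h, Fintype.card_subtype_compl, Fintype.card_subtype_eq]
  omega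

/-- The image of a multigraph under an incidence-preserving pair of maps. -/
def Sub.ofMaps {H G : Multigraph} (f : H.V → G.V) (g : H.E → G.E)
    (h : ∀ e, G.ends (g e) = (H.ends e).map f) : G.Sub where
  verts := Finset.univ.image f
  edges := Finset.univ.image g
  support := by
    intro e he w hw
    obtain ⟨x, -, rfl⟩ := Finset.mem_image.mp he
    rw [h, Sym2.mem_map] at hw
    obtain ⟨y, -, rfl⟩ := hw
    exact Finset.mem_image_of_mem f (Finset.mem_univ y)

theorem Sub.isDense_ofMaps {H G : Multigraph} {f : H.V → G.V} {g : H.E → G.E}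
    (h : ∀ e, G.ends (g e) = (H.ends e).map f) (hf : Function.Injective f)
    (hg : Function.Injective g) {k : ℕ} (hodd : Odd (Fintype.card H.V))
    (hcard : 3 ≤ Fintype.card H.V)
    (hE : 2 * Fintype.card H.E = k * (Fintype.card H.V - 1)) :
    (Sub.ofMaps f g h).IsDense k := by
  simp only [Sub.IsDense, Sub.ofMaps, Finset.card_image_of_injective _ hf,
    Finset.card_image_of_injective _ hg, Finset.card_univ]
  exact ⟨hodd, hcard, hE⟩

end Multigraph

/-- Assuming the Goldberg–Seymour statement, if ρ(G) ≤ k, the graph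
`G''` obtained from `G` by adding a new edge joining distinct vertices `u` and `v`
has Δ(G'') ≤ k−1 and χ'(G'') ≥ k+1, then `G` contains a `k`-dense subgraph whose
vertex set contains both `u` and `v`. -/
theorem dense_subgraph_of_added_edge
    (GS : ∀ H : Multigraph, H.maxDegree + 2 ≤ H.chromaticIndex →
      H.chromaticIndex = ⌈H.density⌉₊)
    (G : Multigraph) (k : ℕ) (hρ : G.density ≤ (k : ℝ))
    (u v : G.V) (huv : u ≠ v)
    (hΔ : ((G.addEdge u v huv).maxDegree : ℤ) ≤ (k : ℤ) - 1)
    (hχ : k + 1 ≤ (G.addEdge u v huv).chromaticIndex) :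
    ∃ S : G.Sub, S.IsDense k ∧ u ∈ S.verts ∧ v ∈ S.verts := by
  have hlt : (k : ℝ) < (G.addEdge u v huv).density := by
    rw [GS _ (by omega)] at hχ
    exact Nat.lt_ceil.mp hχ
  obtain ⟨H, ⟨(f : H.V → G.V), (g : H.E → Option G.E), hf, hg, hends⟩, hodd, hcard, hH⟩ :=
    exists_subgraph_of_lt_density (Nat.cast_nonneg k) hlt
  have hV : (3 : ℝ) ≤ Fintype.card H.V := by exact_mod_cast hcard
  have hpos : (0 : ℝ) < (Fintype.card H.V : ℝ) - 1 := by linarith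
  by_cases hnone : ∃ e₀, g e₀ = none
  · obtain ⟨e₀, he₀⟩ := hnone
    have hsome : ∀ e : (H.deleteEdge e₀).E, ∃ e' : G.E, g e.1 = some e' := fun e =>
      Option.ne_none_iff_exists'.mp fun he => e.2 (hg (he.trans he₀.symm))
    choose g' hg' using hsome
    have hg'inj : Function.Injective g' := fun a b hab =>
      Subtype.ext (hg (by rw [hg', hg', hab]))
    have hends' : ∀ e, G.ends (g' e) = ((H.deleteEdge e₀).ends e).map f := fun e => by
      have := hends e.1
      rw [hg'] at this
      exact this
    have hle := (IsSubgraph.two_mul_card_le_density (H := H.deleteEdge e₀) (G := G)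
      ⟨f, g', hf, hg'inj, hends'⟩ hodd hcard).trans hρ
    change 2 * (Fintype.card (H.deleteEdge e₀).E : ℝ) / ((Fintype.card H.V : ℝ) - 1) ≤ k at hle
    rw [div_le_iff₀ hpos] at hle
    rw [lt_div_iff₀ hpos] at hH
    have hE := H.card_deleteEdge_E_add_one e₀
    have hdense : 2 * Fintype.card (H.deleteEdge e₀).E = k * (Fintype.card H.V - 1) := by
      obtain ⟨m, hm⟩ := hodd
      rw [← hE] at hH
      rw [hm] at hle hH ⊢
      have h₁ : Fintype.card (H.deleteEdge e₀).E ≤ k * m := by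
        have : (Fintype.card (H.deleteEdge e₀).E : ℝ) ≤ k * m := by
          push_cast at hle
          linarith
        exact_mod_cast this
      have h₂ : k * m < Fintype.card (H.deleteEdge e₀).E + 1 := by
        have : (k * m : ℝ) < Fintype.card (H.deleteEdge e₀).E + 1 := by
          push_cast at hH
          linarith
        exact_mod_cast this
      rw [Nat.add_sub_cancel, le_antisymm h₁ (Nat.le_of_lt_succ h₂)]
      ring
    have huv_ends : s(u, v) = (H.ends e₀).map f := by
      have := hends e₀
      rw [he₀] at this
      exact this
    let S : G.Sub := Sub.ofMaps (H := H.deleteEdge e₀) f g' hends'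
    have hmem : ∀ w ∈ s(u, v), w ∈ S.verts := fun w hw => by
      rw [huv_ends, Sym2.mem_map] at hw
      obtain ⟨y, -, rfl⟩ := hw
      exact Finset.mem_image_of_mem f (Finset.mem_univ y)
    exact ⟨S, Sub.isDense_ofMaps hends' hf hg'inj hodd hcard hdense,
      hmem u (Sym2.mem_mk_left u v), hmem v (Sym2.mem_mk_right u v)⟩
  · have hsome : ∀ e : H.E, ∃ e' : G.E, g e = some e' := fun e =>
      Option.ne_none_iff_exists'.mp fun he => hnone ⟨e, he⟩
    choose g' hg' using hsome
    refine absurd ((IsSubgraph.two_mul_card_le_density (H := H) (G := G)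
      ⟨f, g', hf, fun a b hab => hg (by rw [hg', hg', hab]), fun e => ?_⟩
      hodd hcard).trans hρ) hH.not_ge
    have := hends e
    rw [hg'] at this
    exact this
end
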